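/- For all a ≥ 0 and b ≥ 0, the first-order Marcum-Q function Q₁(a, b) = ∫_b^∞ x·exp(−(x² + a²)/2)·I₀(a·x) dx satisfies Q₁(a, b) ≥ exp(−b²/2), where I₀(t) = (1/π)·∫₀^π exp(t·cos θ) dθ. -/

import Mathlib

open MeasureTheory

open Filter Topology

/-- The integral of an even power of the cosine over `[0, π]`. -/
lemma integral_cos_pow_even (k : ℕ) :
    ∫ θ in (0 : ℝ)..Real.pi, Real.cos θ ^ (2 * k) =
      Real.pi * ((2 * k).factorial / (4 ^ k * (k.factorial : ℝ) ^ 2)) := by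
  induction k with
  | zero => simp
  | succ k ih =>
    have h : 2 * (k + 1) = 2 * k + 2 := by ring
    rw [h, integral_cos_pow, ih]
    simp only [Nat.factorial_succ, Real.sin_pi, Real.sin_zero]
    push_cast
    field_simp
    ring

/-- The integral of `exp (t cos θ)` over `[0, π]` only sees the even part of `exp`. -/
lemma integral_exp_mul_cos (t : ℝ) :
    ∫ θ in (0 : ℝ)..Real.pi, Real.exp (t * Real.cos θ) =
      ∫ θ in (0 : ℝ)..Real.pi, Real.cosh (t * Real.cos θ) := by
  have h : ∫ θ in (0 : ℝ)..Real.pi, Real.exp (-(t * Real.cos θ)) =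
      ∫ θ in (0 : ℝ)..Real.pi, Real.exp (t * Real.cos θ) := by
    have := intervalIntegral.integral_comp_sub_left (a := 0) (b := Real.pi)
      (fun θ => Real.exp (t * Real.cos θ)) Real.pi
    simpa [Real.cos_pi_sub] using this
  simp only [Real.cosh_eq]
  rw [intervalIntegral.integral_div, intervalIntegral.integral_add, h]
  · ring
  all_goals exact Continuous.intervalIntegrable (by fun_prop) _ _

/-- Partial sums of the power series of `I₀` bound it from below. -/
lemma sum_le_besselI0 (t : ℝ) (N : ℕ) :
    ∑ k ∈ Finset.range N, (t ^ 2 / 4) ^ k / (k.factorial : ℝ) ^ 2 ≤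
      (1 / Real.pi) * ∫ θ in (0 : ℝ)..Real.pi, Real.exp (t * Real.cos θ) := by
  have h : ∫ θ in (0 : ℝ)..Real.pi,
        ∑ k ∈ Finset.range N, (t * Real.cos θ) ^ (2 * k) / ((2 * k).factorial : ℝ) ≤
      ∫ θ in (0 : ℝ)..Real.pi, Real.cosh (t * Real.cos θ) := by
    refine intervalIntegral.integral_mono_on Real.pi_pos.le
      (Continuous.intervalIntegrable (by fun_prop) _ _)
      (Continuous.intervalIntegrable (by fun_prop) _ _) fun θ _ => ?_
    refine sum_le_hasSum _ (fun k _ => ?_) (Real.hasSum_cosh _)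
    rw [pow_mul]
    positivity
  rw [intervalIntegral.integral_finsetSum
    fun k _ => Continuous.intervalIntegrable (by fun_prop) _ _] at h
  rw [integral_exp_mul_cos]
  have hpi := Real.pi_pos
  calc _ = (1 / Real.pi) * ∑ k ∈ Finset.range N, ∫ θ in (0 : ℝ)..Real.pi,
          (t * Real.cos θ) ^ (2 * k) / ((2 * k).factorial : ℝ) := by
        rw [Finset.mul_sum]
        refine Finset.sum_congr rfl fun k _ => ?_
        simp only [mul_pow, mul_div_assoc]
        rw [intervalIntegral.integral_const_mul, intervalIntegral.integral_div,
          integral_cos_pow_even, div_pow, pow_mul]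
        field_simp
    _ ≤ _ := by gcongr

/-- An antiderivative of `x exp(-x²/2) (x²/2)^k / k!`. -/
lemma hasDerivAt_neg_exp_mul_sum (k : ℕ) (x : ℝ) :
    HasDerivAt (fun y : ℝ => -(Real.exp (-y ^ 2 / 2) *
        ∑ j ∈ Finset.range (k + 1), (y ^ 2 / 2) ^ j / (j.factorial : ℝ)))
      (x * Real.exp (-x ^ 2 / 2) * ((x ^ 2 / 2) ^ k / (k.factorial : ℝ))) x := by
  have hu : HasDerivAt (fun y : ℝ => y ^ 2 / 2) x x := by
    simpa using (hasDerivAt_pow 2 x).div_const 2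
  have he : HasDerivAt (fun y : ℝ => Real.exp (-y ^ 2 / 2)) (Real.exp (-x ^ 2 / 2) * -x) x := by
    simpa [neg_div] using hu.neg.exp
  induction k with
  | zero => simpa [mul_comm] using he.fun_neg
  | succ k ih =>
    have hp := (he.mul ((hu.pow (k + 1)).div_const ((k + 1).factorial : ℝ))).neg
    have := ih.add hp
    simp only [Finset.sum_range_succ _ (k + 1), mul_add, neg_add]
    refine this.congr_deriv ?_
    simp only [Nat.factorial_succ, Pi.pow_apply, Nat.add_sub_cancel]
    push_cast
    field_simp
    ring

/-- The antiderivative of `x exp(-x²/2) (x²/2)^k / k!` vanishes at infinity. -/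
lemma tendsto_neg_exp_mul_sum (k : ℕ) :
    Tendsto (fun y : ℝ => -(Real.exp (-y ^ 2 / 2) *
        ∑ j ∈ Finset.range (k + 1), (y ^ 2 / 2) ^ j / (j.factorial : ℝ))) atTop (𝓝 0) := by
  have hu : Tendsto (fun y : ℝ => y ^ 2 / 2) atTop atTop :=
    (tendsto_pow_atTop two_ne_zero).atTop_div_const two_pos
  have h : Tendsto (fun u : ℝ => -∑ j ∈ Finset.range (k + 1),
      u ^ j * Real.exp (-u) / (j.factorial : ℝ)) atTop (𝓝 0) := by
    have := (tendsto_finsetSum (Finset.range (k + 1)) fun j _ =>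
      (Real.tendsto_pow_mul_exp_neg_atTop_nhds_zero j).div_const (j.factorial : ℝ)).neg
    simpa using this
  refine (h.comp hu).congr fun y => ?_
  simp only [Function.comp_apply, Finset.mul_sum, neg_div]
  congr 1
  exact Finset.sum_congr rfl fun j _ => by ring

lemma integrableOn_mul_exp_mul_pow (k : ℕ) {b : ℝ} (hb : 0 ≤ b) :
    IntegrableOn (fun x : ℝ => x * Real.exp (-x ^ 2 / 2) * ((x ^ 2 / 2) ^ k / (k.factorial : ℝ)))
      (Set.Ioi b) := by
  refine integrableOn_Ioi_deriv_of_nonneg' (fun x _ => hasDerivAt_neg_exp_mul_sum k x)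
    (fun x hx => ?_) (tendsto_neg_exp_mul_sum k)
  have : 0 ≤ x := hb.trans (le_of_lt hx)
  positivity

/-- The tail of the chi-type density `x exp(-x²/2) (x²/2)^k / k!` dominates the Rayleigh tail. -/
lemma exp_le_integral_mul_exp_mul_pow (k : ℕ) {b : ℝ} (hb : 0 ≤ b) :
    Real.exp (-b ^ 2 / 2) ≤ ∫ x in Set.Ioi b,
      x * Real.exp (-x ^ 2 / 2) * ((x ^ 2 / 2) ^ k / (k.factorial : ℝ)) := by
  rw [integral_Ioi_of_hasDerivAt_of_tendsto' (fun x _ => hasDerivAt_neg_exp_mul_sum k x)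
    (integrableOn_mul_exp_mul_pow k hb) (tendsto_neg_exp_mul_sum k), zero_sub, neg_neg]
  refine le_mul_of_one_le_right (Real.exp_pos _).le ?_
  rw [Finset.sum_range_succ']
  simp only [pow_zero, Nat.factorial_zero, Nat.cast_one, div_one, le_add_iff_nonneg_left]
  positivity

/-- The Rician density is integrable. -/
lemma integrable_rician (a : ℝ) :
    Integrable fun x : ℝ => x * Real.exp (-(x ^ 2 + a ^ 2) / 2) *
      ((1 / Real.pi) * ∫ θ in (0 : ℝ)..Real.pi, Real.exp (a * x * Real.cos θ)) := by
  have hg : Integrable fun x : ℝ => Real.exp (a ^ 2) * (x * Real.exp (-(1 / 4) * x ^ 2)) :=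
    (integrable_mul_exp_neg_mul_sq (by norm_num)).const_mul _
  have hc : Continuous fun x : ℝ =>
      ∫ θ in (0 : ℝ)..Real.pi, Real.exp (a * x * Real.cos θ) :=
    intervalIntegral.continuous_parametric_intervalIntegral_of_continuous' (by fun_prop) _ _
  refine hg.mono (by fun_prop) (Eventually.of_forall fun x => ?_)
  have hpi := Real.pi_pos
  have h0 : 0 ≤ ∫ θ in (0 : ℝ)..Real.pi, Real.exp (a * x * Real.cos θ) :=
    intervalIntegral.integral_nonneg hpi.le fun θ _ => (Real.exp_pos _).le
  have h1 : (1 / Real.pi) * ∫ θ in (0 : ℝ)..Real.pi, Real.exp (a * x * Real.cos θ) ≤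
      Real.exp |a * x| := by
    have : ∫ θ in (0 : ℝ)..Real.pi, Real.exp (a * x * Real.cos θ) ≤
        ∫ _ in (0 : ℝ)..Real.pi, Real.exp |a * x| := by
      refine intervalIntegral.integral_mono_on hpi.le
        (Continuous.intervalIntegrable (by fun_prop) _ _)
        (Continuous.intervalIntegrable (by fun_prop) _ _) fun θ _ => Real.exp_le_exp.2 ?_
      refine (le_abs_self _).trans ?_
      rw [abs_mul]
      exact mul_le_of_le_one_right (abs_nonneg _) (Real.abs_cos_le_one θ)
    rw [intervalIntegral.integral_const, smul_eq_mul, sub_zero] at this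
    rw [one_div, inv_mul_le_iff₀ hpi]
    exact this
  have hnn : 0 ≤ (1 / Real.pi) * ∫ θ in (0 : ℝ)..Real.pi, Real.exp (a * x * Real.cos θ) := by
    positivity
  simp only [Real.norm_eq_abs, abs_mul _ (_ * ∫ _ in _.._, _), abs_of_nonneg hnn]
  simp only [abs_mul, Real.abs_exp] at h1 ⊢
  calc _ ≤ |x| * Real.exp (-(x ^ 2 + a ^ 2) / 2) * Real.exp (|a| * |x|) := by gcongr
    _ = |x| * Real.exp (-(x ^ 2 + a ^ 2) / 2 + |a| * |x|) := by rw [Real.exp_add]; ring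
    _ ≤ |x| * Real.exp (a ^ 2 + -(1 / 4) * x ^ 2) := by
        refine mul_le_mul_of_nonneg_left (Real.exp_le_exp.2 ?_) (abs_nonneg x)
        nlinarith [sq_nonneg (|x| / 2 - |a|), sq_abs x, sq_abs a, sq_nonneg a]
    _ = _ := by rw [Real.exp_add]; ring

/-- The first-order Marcum-Q function
`Q₁(a, b) = ∫_b^∞ x·exp(−(x² + a²)/2)·I₀(a·x) dx` satisfies
`Q₁(a, b) ≥ exp(−b²/2)` for `a, b ≥ 0`, where
`I₀(t) = (1/π)·∫₀^π exp(t·cos θ) dθ`. -/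
theorem marcumQ_ge_exp (a b : ℝ) (ha : 0 ≤ a) (hb : 0 ≤ b) :
    Real.exp (-b ^ 2 / 2) ≤
      ∫ x in Set.Ici b, x * Real.exp (-(x ^ 2 + a ^ 2) / 2) *
        ((1 / Real.pi) *
          ∫ θ in (0 : ℝ)..Real.pi, Real.exp (a * x * Real.cos θ)) := by
  rw [integral_Ici_eq_integral_Ioi]
  set Q := ∫ x in Set.Ioi b, x * Real.exp (-(x ^ 2 + a ^ 2) / 2) *
    ((1 / Real.pi) * ∫ θ in (0 : ℝ)..Real.pi, Real.exp (a * x * Real.cos θ))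
  have key (N : ℕ) : Real.exp (-a ^ 2 / 2) * (Real.exp (-b ^ 2 / 2) *
      ∑ k ∈ Finset.range N, (a ^ 2 / 2) ^ k / (k.factorial : ℝ)) ≤ Q := by
    have hint (k : ℕ) := (integrableOn_mul_exp_mul_pow k hb).const_mul
      (Real.exp (-a ^ 2 / 2) * ((a ^ 2 / 2) ^ k / (k.factorial : ℝ)))
    calc _ = ∑ k ∈ Finset.range N, Real.exp (-a ^ 2 / 2) * ((a ^ 2 / 2) ^ k / (k.factorial : ℝ)) *
            Real.exp (-b ^ 2 / 2) := by
          simp only [Finset.mul_sum]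
          exact Finset.sum_congr rfl fun k _ => by ring
      _ ≤ ∑ k ∈ Finset.range N, Real.exp (-a ^ 2 / 2) * ((a ^ 2 / 2) ^ k / (k.factorial : ℝ)) *
            ∫ x in Set.Ioi b,
              x * Real.exp (-x ^ 2 / 2) * ((x ^ 2 / 2) ^ k / (k.factorial : ℝ)) := by
          gcongr with k
          exact exp_le_integral_mul_exp_mul_pow k hb
      _ = ∫ x in Set.Ioi b, ∑ k ∈ Finset.range N,
            Real.exp (-a ^ 2 / 2) * ((a ^ 2 / 2) ^ k / (k.factorial : ℝ)) *
              (x * Real.exp (-x ^ 2 / 2) * ((x ^ 2 / 2) ^ k / (k.factorial : ℝ))) := by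
          rw [integral_finsetSum _ fun k _ => hint k]
          simp only [integral_const_mul]
      _ ≤ Q := by
          refine setIntegral_mono_on (integrable_finsetSum _ fun k _ => hint k)
            (integrable_rician a).integrableOn measurableSet_Ioi fun x hx => ?_
          have hx0 : 0 ≤ x := hb.trans (le_of_lt hx)
          calc _ = x * Real.exp (-(x ^ 2 + a ^ 2) / 2) *
                ∑ k ∈ Finset.range N, ((a * x) ^ 2 / 4) ^ k / (k.factorial : ℝ) ^ 2 := by
                have : -(x ^ 2 + a ^ 2) / 2 = -a ^ 2 / 2 + -x ^ 2 / 2 := by ring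
                rw [this, Real.exp_add, Finset.mul_sum]
                refine Finset.sum_congr rfl fun k _ => ?_
                have : (a * x) ^ 2 / 4 = a ^ 2 / 2 * (x ^ 2 / 2) := by ring
                rw [this, mul_pow]
                ring
            _ ≤ _ := by
                gcongr
                exact sum_le_besselI0 (a * x) N
  have hlim := (((NormedSpace.expSeries_div_hasSum_exp (a ^ 2 / 2)).tendsto_sum_nat).const_mul
    (Real.exp (-b ^ 2 / 2))).const_mul (Real.exp (-a ^ 2 / 2))
  have := le_of_tendsto' hlim key
  rw [← Real.exp_eq_exp_ℝ, mul_left_comm, ← Real.exp_add] at this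
  simpa [neg_div] using this
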